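/- Let T be the 3-regular tree with a distinguished edge e separating T into subtrees T₁ and T₂. Then there exists a 1-cycle s on T, lying in ℓ^q of the edge set for every q > 1, whose pairing with the 1-cochain supported on the single edge e (taking value 1 there) is nonzero; consequently any function on the vertices of T which is constant equal to 0 on T₁ and constant equal to 1 on T₂ has nonzero coupling with s. -/

import Mathlib

open SimpleGraph

section Parent

variable {V : Type*} {T : SimpleGraph V}

/-- In a connected graph every vertex other than the root `r` has a neighbor closer to `r`. -/
theorem exists_adj_dist_eq_add_one (hT : T.Connected) {r x : V} (hx : x ≠ r) :
    ∃ z, T.Adj x z ∧ T.dist r x = T.dist r z + 1 := by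
  obtain ⟨p, hp⟩ := hT.exists_walk_length_eq_dist x r
  cases p with
  | nil => exact absurd rfl hx
  | cons h p =>
    rename_i z
    refine ⟨z, h, ?_⟩
    rw [Walk.length_cons, dist_comm] at hp
    have h₁ := T.dist_le p
    have h₂ := hT.dist_triangle (u := r) (v := z) (w := x)
    rw [dist_eq_one_iff_adj.mpr h.symm] at h₂
    rw [dist_comm (u := z)] at h₁
    omega

/-- In a tree a vertex has at most one neighbor closer to the root `r`. -/
theorem SimpleGraph.IsTree.eq_of_adj_of_dist_eq_add_one (hT : T.IsTree) {r x y z : V}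
    (hy : T.Adj x y) (hz : T.Adj x z)
    (hdy : T.dist r x = T.dist r y + 1) (hdz : T.dist r x = T.dist r z + 1) : y = z := by
  obtain ⟨p, hp⟩ := hT.connected.exists_walk_length_eq_dist y r
  obtain ⟨p', hp'⟩ := hT.connected.exists_walk_length_eq_dist z r
  have h₁ : (Walk.cons hy p).IsPath := Walk.isPath_of_length_eq_dist _ <| by
    rw [Walk.length_cons, hp, dist_comm (u := y), dist_comm (u := x), hdy]
  have h₂ : (Walk.cons hz p').IsPath := Walk.isPath_of_length_eq_dist _ <| by
    rw [Walk.length_cons, hp', dist_comm (u := z), dist_comm (u := x), hdz]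
  have h := congrArg Subtype.val
    ((hT.isAcyclic.subsingleton_path x r).elim ⟨_, h₁⟩ ⟨_, h₂⟩)
  simpa using congrArg Walk.snd h

/-- The only edge of a tree joining the two sides of the edge `ab` is `ab` itself. -/
theorem SimpleGraph.IsTree.eq_of_adj_of_dist_lt (hT : T.IsTree) {a b x y : V} (hab : T.Adj a b)
    (hxy : T.Adj x y) (hx : T.dist a x < T.dist b x) (hy : T.dist b y < T.dist a y) :
    x = a ∧ y = b := by
  have hx' := hT.dist_eq_dist_add_one_of_adj x hab
  have hy' := hT.dist_eq_dist_add_one_of_adj y hab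
  have ha := hT.dist_eq_dist_add_one_of_adj a hxy
  have hb := hT.dist_eq_dist_add_one_of_adj b hxy
  rw [dist_comm (u := x), dist_comm (u := x)] at hx'
  rw [dist_comm (u := y), dist_comm (u := y)] at hy'
  by_cases hxa : x = a
  · subst hxa
    refine ⟨rfl, ?_⟩
    rw [dist_self] at *
    exact (hT.connected.dist_eq_zero_iff.mp (by omega : T.dist b y = 0)).symm
  · obtain ⟨z, hz, hdz⟩ := exists_adj_dist_eq_add_one hT.connected hxa
    have hz' := hT.dist_eq_dist_add_one_of_adj z hab
    have hbz := hT.dist_eq_dist_add_one_of_adj b hz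
    rw [dist_comm (u := z), dist_comm (u := z)] at hz'
    have := hT.eq_of_adj_of_dist_eq_add_one (r := b) hxy hz (by omega) (by omega)
    subst this
    omega

end Parent

section Cubic

variable {V : Type*} {T : SimpleGraph V}

/-- The boundary of the gradient of `x ↦ 2 ^ (-dist r x)` on the 3-regular tree is concentrated
at the root `r`. -/
theorem hasSum_gradient_half_pow_dist [DecidableEq V] [DecidableRel T.Adj] (hT : T.IsTree)
    (h3 : ∀ v : V, (T.neighborSet v).ncard = 3) (r x : V) :
    HasSum (fun y => if T.Adj x y then (1 / 2 : ℝ) ^ T.dist r y - (1 / 2) ^ T.dist r x else 0)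
      (if x = r then -3 / 2 else 0) := by
  have hfin : (T.neighborSet x).Finite := Set.finite_of_ncard_pos (by rw [h3]; norm_num)
  have hcard : hfin.toFinset.card = 3 := by rw [← Set.ncard_eq_toFinset_card _ hfin, h3]
  have hmem : ∀ y, y ∈ hfin.toFinset ↔ T.Adj x y := by simp
  have hsum := hasSum_sum_of_ne_finset_zero (L := .unconditional V) (s := hfin.toFinset)
    (f := fun y => if T.Adj x y then (1 / 2 : ℝ) ^ T.dist r y - (1 / 2) ^ T.dist r x else 0)
    (fun y hy => if_neg (mt (hmem y).mpr hy))
  convert hsum using 1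
  by_cases hx : x = r
  · subst hx
    rw [if_pos rfl, Finset.sum_congr rfl (g := fun _ => (-1 / 2 : ℝ)), Finset.sum_const, hcard]
    · norm_num
    · intro y hy
      rw [hmem] at hy
      rw [if_pos hy, dist_eq_one_iff_adj.mpr hy, dist_self]
      norm_num
  · obtain ⟨z, hz, hdz⟩ := exists_adj_dist_eq_add_one hT.connected hx
    rw [if_neg hx, ← Finset.add_sum_erase _ _ ((hmem z).mpr hz),
      Finset.sum_congr rfl (g := fun _ => -(1 / 2 : ℝ) ^ T.dist r x / 2), Finset.sum_const,
      Finset.card_erase_of_mem ((hmem z).mpr hz), hcard, if_pos hz, hdz, pow_succ]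
    · norm_num
      ring
    · intro y hy
      rw [Finset.mem_erase, hmem] at hy
      rcases hT.dist_eq_dist_add_one_of_adj r hy.2 with h | h
      · exact absurd (hT.eq_of_adj_of_dist_eq_add_one hy.2 hz h hdz) hy.1
      · rw [if_pos hy.2, h, pow_succ]
        ring

/-- The sphere of radius `n` in the 3-regular tree is finite with at most `3 * 2 ^ n` vertices. -/
theorem exists_sphere_card_le (hT : T.IsTree)
    (h3 : ∀ v : V, (T.neighborSet v).ncard = 3) (r : V) (n : ℕ) :
    ∃ F : Finset V, F.card ≤ 3 * 2 ^ n ∧ ∀ x, x ∈ F ↔ T.dist r x = n := by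
  classical
  have hfin : ∀ x, (T.neighborSet x).Finite := fun x =>
    Set.finite_of_ncard_pos (by rw [h3]; norm_num)
  have hcard : ∀ x, (hfin x).toFinset.card = 3 := fun x => by
    rw [← Set.ncard_eq_toFinset_card _ (hfin x), h3]
  have hmem : ∀ x y, y ∈ (hfin x).toFinset ↔ T.Adj x y := by simp
  have hsucc : ∀ n, ∃ F : Finset V, F.card ≤ 3 * 2 ^ n ∧ ∀ x, x ∈ F ↔ T.dist r x = n + 1 := by
    intro n
    induction n with
    | zero =>
      exact ⟨(hfin r).toFinset, by simp [hcard],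
        fun x => by rw [hmem, zero_add, dist_eq_one_iff_adj]⟩
    | succ n ih =>
      obtain ⟨F, hF, hFmem⟩ := ih
      refine ⟨F.biUnion fun x => (hfin x).toFinset.filter fun y => T.dist r y = n + 1 + 1, ?_, ?_⟩
      · refine (Finset.card_biUnion_le_card_mul _ _ 2 fun x hx => ?_).trans ?_
        · rw [hFmem] at hx
          have hxr : x ≠ r := by rintro rfl; simp at hx
          obtain ⟨z, hz, hdz⟩ := exists_adj_dist_eq_add_one hT.connected hxr
          calc _ ≤ ((hfin x).toFinset.erase z).card := Finset.card_le_card fun y hy => by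
                rw [Finset.mem_filter] at hy
                refine Finset.mem_erase.mpr ⟨?_, hy.1⟩
                rintro rfl
                omega
            _ = 2 := by rw [Finset.card_erase_of_mem ((hmem x z).mpr hz), hcard]
        · rw [pow_succ]
          omega
      · intro y
        simp only [Finset.mem_biUnion, Finset.mem_filter, hmem, hFmem]
        refine ⟨fun ⟨_, _, _, h⟩ => h, fun h => ?_⟩
        have hyr : y ≠ r := by rintro rfl; simp at h
        obtain ⟨z, hz, hdz⟩ := exists_adj_dist_eq_add_one hT.connected hyr
        exact ⟨z, by omega, hz.symm, h⟩
  cases n with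
  | zero =>
    exact ⟨{r}, by simp,
      fun x => by rw [Finset.mem_singleton, hT.connected.dist_eq_zero_iff, eq_comm]⟩
  | succ n =>
    obtain ⟨F, hF, hFmem⟩ := hsucc n
    exact ⟨F, hF.trans (by rw [pow_succ]; omega), hFmem⟩

theorem summable_pow_dist (hT : T.IsTree) (h3 : ∀ v : V, (T.neighborSet v).ncard = 3) (r : V)
    {c : ℝ} (hc : 0 ≤ c) (hc' : c < 1 / 2) : Summable fun x => c ^ T.dist r x := by
  classical
  have hgeom : Summable fun n : ℕ => 3 * (2 * c) ^ n :=
    (summable_geometric_of_lt_one (by positivity) (by linarith)).mul_left 3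
  refine summable_of_sum_le (c := ∑' n : ℕ, 3 * (2 * c) ^ n) (fun x => by positivity) fun u => ?_
  rw [← Finset.sum_fiberwise_of_maps_to (t := u.image (T.dist r))
    (fun x hx => Finset.mem_image_of_mem _ hx)]
  refine le_trans (Finset.sum_le_sum fun n _ => ?_)
    (hgeom.sum_le_tsum (u.image (T.dist r)) fun n _ => by positivity)
  obtain ⟨F, hF, hFmem⟩ := exists_sphere_card_le hT h3 r n
  rw [Finset.sum_congr rfl (g := fun _ => c ^ n)
    fun x hx => by rw [(Finset.mem_filter.mp hx).2], Finset.sum_const, nsmul_eq_mul]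
  have hle : ((u.filter fun x => T.dist r x = n).card : ℝ) ≤ 3 * 2 ^ n := by
    exact_mod_cast (Finset.card_le_card fun x hx =>
      (hFmem x).mpr (Finset.mem_filter.mp hx).2).trans hF
  calc _ ≤ 3 * 2 ^ n * c ^ n := by gcongr
    _ = 3 * (2 * c) ^ n := by rw [mul_pow, mul_assoc]

theorem summable_adj_pow_dist [DecidableRel T.Adj] (hT : T.IsTree)
    (h3 : ∀ v : V, (T.neighborSet v).ncard = 3) (r : V)
    {c : ℝ} (hc : 0 ≤ c) (hc' : c < 1 / 2) :
    Summable fun e : V × V => if T.Adj e.1 e.2 then c ^ T.dist r e.1 else 0 := by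
  have hrow : ∀ x, HasSum (fun y => if T.Adj x y then c ^ T.dist r x else 0)
      (3 * c ^ T.dist r x) := by
    intro x
    have hfin : (T.neighborSet x).Finite := Set.finite_of_ncard_pos (by rw [h3]; norm_num)
    have hcard : hfin.toFinset.card = 3 := by rw [← Set.ncard_eq_toFinset_card _ hfin, h3]
    have hmem : ∀ y, y ∈ hfin.toFinset ↔ T.Adj x y := by simp
    convert hasSum_sum_of_ne_finset_zero (L := .unconditional V) (s := hfin.toFinset)
      (f := fun y => if T.Adj x y then c ^ T.dist r x else 0)
      (fun y hy => if_neg (mt (hmem y).mpr hy)) using 1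
    rw [Finset.sum_congr rfl fun y hy => if_pos ((hmem y).mp hy), Finset.sum_const, hcard]
    simp
  refine (summable_prod_of_nonneg fun e => ?_).mpr ⟨fun x => (hrow x).summable, ?_⟩
  · dsimp only
    split_ifs
    · positivity
    · exact le_rfl
  · exact ((summable_pow_dist hT h3 r hc hc').mul_left 3).congr fun x => (hrow x).tsum_eq.symm

theorem abs_gradient_half_pow_dist_le (hT : T.IsTree) (r : V) {x y : V} (hxy : T.Adj x y) :
    |(1 / 2 : ℝ) ^ T.dist r y - (1 / 2) ^ T.dist r x| ≤ (1 / 2) ^ T.dist r x := by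
  rw [abs_le]
  rcases hT.dist_eq_dist_add_one_of_adj r hxy with h | h
  all_goals
    rw [h, pow_succ]
    constructor <;> linarith [show (0 : ℝ) < (1 / 2) ^ T.dist r x by positivity,
      show (0 : ℝ) < (1 / 2) ^ T.dist r y by positivity]

/-- The cycle on a tree with edge `ab`: the gradient of the difference of the functions
`x ↦ 2 ^ (-dist b x)` and `x ↦ 2 ^ (-dist a x)`, corrected on `ab` to have zero boundary. -/
noncomputable def edgeCycle [DecidableEq V] (T : SimpleGraph V) [DecidableRel T.Adj] (a b : V)
    (e : V × V) : ℝ :=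
  (if T.Adj e.1 e.2 then (1 / 2 : ℝ) ^ T.dist b e.2 - (1 / 2) ^ T.dist b e.1 else 0)
    - (if T.Adj e.1 e.2 then (1 / 2 : ℝ) ^ T.dist a e.2 - (1 / 2) ^ T.dist a e.1 else 0)
    - (if e.1 = a ∧ e.2 = b then 3 / 2 else 0) + (if e.1 = b ∧ e.2 = a then 3 / 2 else 0)

variable [DecidableEq V] [DecidableRel T.Adj]

theorem edgeCycle_of_not_adj {a b x y : V} (hab : T.Adj a b) (h : ¬ T.Adj x y) :
    edgeCycle T a b (x, y) = 0 := by
  have h₁ : ¬ (x = a ∧ y = b) := by rintro ⟨rfl, rfl⟩; exact h hab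
  have h₂ : ¬ (x = b ∧ y = a) := by rintro ⟨rfl, rfl⟩; exact h hab.symm
  simp [edgeCycle, h, h₁, h₂]

theorem edgeCycle_swap (a b x y : V) :
    edgeCycle T a b (y, x) = - edgeCycle T a b (x, y) := by
  simp only [edgeCycle, T.adj_comm y x, and_comm (a := y = a), and_comm (a := y = b)]
  split_ifs <;> ring

theorem edgeCycle_self {a b : V} (hab : T.Adj a b) : edgeCycle T a b (a, b) = -1 / 2 := by
  simp only [edgeCycle, hab, if_true, and_self, hab.ne, false_and, if_false, dist_self,
    dist_eq_one_iff_adj.mpr hab, dist_eq_one_iff_adj.mpr hab.symm]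
  norm_num

theorem hasSum_edgeCycle (hT : T.IsTree) (h3 : ∀ v : V, (T.neighborSet v).ncard = 3) (a b x : V) :
    HasSum (fun y => edgeCycle T a b (x, y)) 0 := by
  have hsingle : ∀ u v : V, HasSum (fun y => if x = u ∧ y = v then (3 / 2 : ℝ) else 0)
      (if x = u then 3 / 2 else 0) := fun u v => by
    simpa using hasSum_single (L := .unconditional V)
      (f := fun y => if x = u ∧ y = v then (3 / 2 : ℝ) else 0) v
      fun y hy => if_neg fun h => hy h.2
  have h := (((hasSum_gradient_half_pow_dist hT h3 b x).sub
    (hasSum_gradient_half_pow_dist hT h3 a x)).sub (hsingle a b)).add (hsingle b a)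
  have hzero : (if x = b then -3 / 2 else 0) - (if x = a then -3 / 2 else 0)
      - (if x = a then 3 / 2 else 0) + (if x = b then 3 / 2 else 0) = (0 : ℝ) := by
    split_ifs <;> norm_num
  rwa [hzero] at h

theorem abs_edgeCycle_le (hT : T.IsTree) {a b : V} (hab : T.Adj a b) (e : V × V) :
    |edgeCycle T a b e| ≤ if T.Adj e.1 e.2 then 10 * (1 / 2 : ℝ) ^ T.dist a e.1 else 0 := by
  obtain ⟨x, y⟩ := e
  by_cases hxy : T.Adj x y
  swap
  · simp [edgeCycle_of_not_adj hab hxy, hxy]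
  have ha := abs_le.mp (abs_gradient_half_pow_dist_le hT a hxy)
  have hb := abs_le.mp (abs_gradient_half_pow_dist_le hT b hxy)
  have hpos : (0 : ℝ) < (1 / 2) ^ T.dist a x := by positivity
  have hcomp : (1 / 2 : ℝ) ^ T.dist b x ≤ 2 * (1 / 2) ^ T.dist a x := by
    have h := hT.dist_eq_dist_add_one_of_adj x hab
    rw [dist_comm (u := x), dist_comm (u := x)] at h
    rcases h with h | h <;>
    · rw [h, pow_succ]
      linarith [show (0 : ℝ) < (1 / 2) ^ T.dist b x by positivity]
  have hxa : x = a → (1 / 2 : ℝ) ^ T.dist a x = 1 := by rintro rfl; simp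
  have hxb : x = b → (1 / 2 : ℝ) ^ T.dist a x = 1 / 2 := by
    rintro rfl
    rw [dist_eq_one_iff_adj.mpr hab, pow_one]
  simp only [edgeCycle, hxy, if_true]
  rw [abs_le]
  split_ifs with h₁ h₂ h₂
  · exact absurd (h₁.1.symm.trans h₂.1) hab.ne
  · have := hxa h₁.1
    constructor <;> linarith
  · have := hxb h₂.1
    constructor <;> linarith
  · constructor <;> linarith

theorem summable_abs_edgeCycle_rpow (hT : T.IsTree) (h3 : ∀ v : V, (T.neighborSet v).ncard = 3)
    {a b : V} (hab : T.Adj a b) {q : ℝ} (hq : 1 < q) :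
    Summable fun e => |edgeCycle T a b e| ^ q := by
  have hc : (1 / 2 : ℝ) ^ q < 1 / 2 := by
    simpa using Real.rpow_lt_rpow_of_exponent_gt (by norm_num : (0 : ℝ) < 1 / 2) (by norm_num) hq
  refine Summable.of_nonneg_of_le (fun e => by positivity) (fun e => ?_)
    ((summable_adj_pow_dist hT h3 a (by positivity) hc).mul_left ((10 : ℝ) ^ q))
  refine (Real.rpow_le_rpow (abs_nonneg _) (abs_edgeCycle_le hT hab e) (by linarith)).trans_eq ?_
  split_ifs
  · rw [Real.mul_rpow (by norm_num) (by positivity), Real.rpow_pow_comm (by norm_num)]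
  · rw [Real.zero_rpow (by linarith), mul_zero]

/-- The coupling of an indicator function of one side of `ab` with a chain on the edges only sees
the edge `ab`. -/
theorem tsum_coupling_eq (hT : T.IsTree) {a b : V} (hab : T.Adj a b) {s : V × V → ℝ}
    (hs : ∀ x y, ¬ T.Adj x y → s (x, y) = 0) (hanti : ∀ x y, s (y, x) = - s (x, y)) {f : V → ℝ}
    (hfa : ∀ x, T.dist x a < T.dist x b → f x = 0)
    (hfb : ∀ x, T.dist x b < T.dist x a → f x = 1) :
    ∑' e : V × V, (f e.1 - f e.2) * s e = -2 * s (a, b) := by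
  have hside : ∀ x, T.dist a x < T.dist b x ∧ f x = 0 ∨ T.dist b x < T.dist a x ∧ f x = 1 := by
    intro x
    rw [dist_comm (u := a), dist_comm (u := b)]
    exact (hT.dist_ne_of_adj x hab).lt_or_gt.imp (fun h => ⟨h, hfa x h⟩) fun h => ⟨h, hfb x h⟩
  have hfa' : f a = 0 := hfa a (by simp [dist_eq_one_iff_adj.mpr hab])
  have hfb' : f b = 1 := hfb b (by simp [dist_eq_one_iff_adj.mpr hab.symm])
  rw [tsum_eq_sum (s := {(a, b), (b, a)}), Finset.sum_pair (by simp [hab.ne]), hanti a b]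
  · simp only [hfa', hfb']
    ring
  · rintro ⟨x, y⟩ hxy
    simp only [Finset.mem_insert, Finset.mem_singleton, Prod.mk.injEq, not_or] at hxy
    by_cases hadj : T.Adj x y
    · rcases hside x with ⟨hx, hfx⟩ | ⟨hx, hfx⟩ <;> rcases hside y with ⟨hy, hfy⟩ | ⟨hy, hfy⟩
      · simp [hfx, hfy]
      · exact absurd (hT.eq_of_adj_of_dist_lt hab hadj hx hy) hxy.1
      · exact absurd (hT.eq_of_adj_of_dist_lt hab hadj.symm hy hx).symm hxy.2
      · simp [hfx, hfy]
    · simp [hs x y hadj]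

end Cubic


/-- Let `T` be the 3-regular tree with a distinguished edge `e = (a, b)`
separating `T` into the subtrees `T₁` (vertices strictly closer to `a`) and `T₂` (vertices
strictly closer to `b`).  Then there is a `1`-cycle `s` on `T`, lying in `ℓ^q` of the edge
set for every `q > 1`, whose pairing with the `1`-cochain supported on the single edge `e`
(with value `1` there) is nonzero — i.e. `s(a, b) ≠ 0` — and consequently every vertex
function that is `0` on `T₁` and `1` on `T₂` has nonzero coupling with `s`. -/
theorem stmt13 {V : Type*} (T : SimpleGraph V) (hT : T.IsTree)
    (h3 : ∀ v : V, (T.neighborSet v).ncard = 3)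
    (a b : V) (hab : T.Adj a b) :
    ∃ s : V × V → ℝ,
      -- `s` is a 1-chain supported on the edges
      (∀ x y : V, ¬ T.Adj x y → s (x, y) = 0) ∧
      -- antisymmetry (orientation)
      (∀ x y : V, s (y, x) = - s (x, y)) ∧
      -- `s` is a cycle: zero boundary at every vertex
      (∀ x : V, ∑' y : V, s (x, y) = 0) ∧
      -- `s ∈ ℓ^q` for every `q > 1`
      (∀ q : ℝ, 1 < q → Summable fun e : V × V => |s e| ^ q) ∧
      -- nonzero pairing with the unit cochain on the edge `e = (a, b)`
      s (a, b) ≠ 0 ∧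
      -- nonzero coupling with any vertex function that is 0 on `T₁` and 1 on `T₂`
      (∀ f : V → ℝ,
        (∀ x : V, T.dist x a < T.dist x b → f x = 0) →
        (∀ x : V, T.dist x b < T.dist x a → f x = 1) →
        ∑' e : V × V, (f e.1 - f e.2) * s e ≠ 0) := by
  classical
  refine ⟨edgeCycle T a b, fun x y => edgeCycle_of_not_adj hab, edgeCycle_swap a b,
    fun x => (hasSum_edgeCycle hT h3 a b x).tsum_eq,
    fun q => summable_abs_edgeCycle_rpow hT h3 hab, ?_, fun f hfa hfb => ?_⟩
  · rw [edgeCycle_self hab]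
    norm_num
  · rw [tsum_coupling_eq hT hab (fun x y => edgeCycle_of_not_adj hab) (edgeCycle_swap a b) hfa hfb,
      edgeCycle_self hab]
    norm_num
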